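/- Let O be a coquasitriangular Hopf algebra over a field k with co-R-matrix R : O ⊗ O → k, and let L denote O with the right adjoint coaction cad(φ) = φ₍₂₎ ⊗ S(φ₍₁₎)φ₍₃₎ and the braided (transmutation) product φ ⊙ ψ = R(S(φ₍₁₎)φ₍₃₎ ⊗ S(ψ₍₁₎)) φ₍₂₎ψ₍₂₎ with unit 1_O. Then ⊙ is associative with unit 1_O, and the coadjoint coaction makes (L, ⊙, 1) an algebra object in the category of right O-comodules (i.e., ⊙ and the unit are comodule morphisms). -/

import Mathlib

open TensorProduct Coalgebra

noncomputable section

variable (k O : Type*) [Field k] [Ring O] [HopfAlgebra k O]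

/-- The multiplication of `O` as a linear map. -/
abbrev mulO : O ⊗[k] O →ₗ[k] O := LinearMap.mul' k O

/-- The antipode of `O`. -/
abbrev Sa : O →ₗ[k] O := HopfAlgebra.antipode (R := k)

/-- The flip `O ⊗ O ≃ O ⊗ O`. -/
abbrev commO : O ⊗[k] O →ₗ[k] O ⊗[k] O := (TensorProduct.comm k O O).toLinearMap

/-- The middle-four interchange `(a ⊗ b) ⊗ (c ⊗ d) ↦ (a ⊗ c) ⊗ (b ⊗ d)`. -/
abbrev ttt : (O ⊗[k] O) ⊗[k] (O ⊗[k] O) →ₗ[k] (O ⊗[k] O) ⊗[k] (O ⊗[k] O) :=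
  (tensorTensorTensorComm k O O O O).toLinearMap

/-- The iterated comultiplication `φ ↦ φ₍₁₎ ⊗ (φ₍₂₎ ⊗ φ₍₃₎)`. -/
abbrev comul₂ : O →ₗ[k] O ⊗[k] (O ⊗[k] O) :=
  LinearMap.lTensor O Coalgebra.comul ∘ₗ Coalgebra.comul

/-- The linear map `φ ↦ (S(φ₍₁₎) φ₍₃₎) ⊗ φ₍₂₎`. -/
def kappa : O →ₗ[k] O ⊗[k] O :=
  LinearMap.rTensor O (mulO k O ∘ₗ TensorProduct.map (Sa k O) LinearMap.id) ∘ₗ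
    (TensorProduct.assoc k O O O).symm.toLinearMap ∘ₗ
      LinearMap.lTensor O (commO k O) ∘ₗ comul₂ k O

/-- The right adjoint coaction `cad(φ) = φ₍₂₎ ⊗ S(φ₍₁₎) φ₍₃₎`. -/
def cad : O →ₗ[k] O ⊗[k] O :=
  LinearMap.lTensor O (mulO k O ∘ₗ TensorProduct.map (Sa k O) LinearMap.id) ∘ₗ
    (TensorProduct.assoc k O O O).toLinearMap ∘ₗ
      LinearMap.rTensor O (commO k O) ∘ₗ
        (TensorProduct.assoc k O O O).symm.toLinearMap ∘ₗ comul₂ k O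

/-- The map `ψ ↦ S(ψ₍₁₎) ⊗ ψ₍₂₎`. -/
def lamS : O →ₗ[k] O ⊗[k] O :=
  TensorProduct.map (Sa k O) LinearMap.id ∘ₗ Coalgebra.comul

variable {k O} (R : O ⊗[k] O →ₗ[k] k)

/-- The transmutation (braided) product on `L = O`:
`φ ⊙ ψ = R(S(φ₍₁₎)φ₍₃₎ ⊗ S(ψ₍₁₎)) φ₍₂₎ ψ₍₂₎`. -/
def transMul : O ⊗[k] O →ₗ[k] O :=
  (TensorProduct.lid k O).toLinearMap ∘ₗ TensorProduct.map R (mulO k O) ∘ₗ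
    ttt k O ∘ₗ TensorProduct.map (kappa k O) (lamS k O)

/-- A square matrix over a coalgebra whose entries satisfy `Δ(Tᵢⱼ) = ∑ₐ Tᵢₐ ⊗ Tₐⱼ` and
`ε(Tᵢⱼ) = δᵢⱼ`, like the coefficients of a matrix representation. -/
structure IsComatrix (K : Type*) {C n : Type*} [CommSemiring K] [AddCommMonoid C] [Module K C]
    [Coalgebra K C] [Fintype n] [DecidableEq n] (T : Matrix n n C) : Prop where
  comul : ∀ i j, Coalgebra.comul (R := K) (T i j) = ∑ a, T i a ⊗ₜ[K] T a j
  counit : ∀ i j, Coalgebra.counit (R := K) (T i j) = (1 : Matrix n n K) i j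

section Existence

variable {C : Type*} [AddCommGroup C] [Module k C] [Coalgebra k C]

/-- Every element of a coalgebra over a field is a linear combination of the entries of a finite
comatrix. -/
theorem exists_isComatrix_mem_span (x : C) :
    ∃ (n : ℕ) (T : Matrix (Fin n) (Fin n) C), IsComatrix k T ∧
      x ∈ Submodule.span k (Set.range fun p : Fin n × Fin n => T p.1 p.2) := by
  classical
  let contract (g : Module.Dual k C) : C ⊗[k] C →ₗ[k] C :=
    (TensorProduct.rid k C).toLinearMap ∘ₗ LinearMap.lTensor C g
  let orbit : Module.Dual k C →ₗ[k] C :=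
    { toFun := fun g => contract g (comul x)
      map_add' := by simp [contract, LinearMap.lTensor_add]
      map_smul' := by simp [contract, LinearMap.lTensor_smul] }
  let V := LinearMap.range orbit
  have hfin : FiniteDimensional k V := by
    let 𝓡 := ℛ k x
    have : FiniteDimensional k (Submodule.span k (Set.image 𝓡.left (𝓡.index : Set _))) :=
      FiniteDimensional.span_of_finite k ((Finset.finite_toSet _).image _)
    refine Submodule.finiteDimensional_of_le
      (S₂ := Submodule.span k (Set.image 𝓡.left (𝓡.index : Set _))) ?_
    rintro _ ⟨g, rfl⟩
    change contract g (comul x) ∈ _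
    rw [← 𝓡.eq, map_sum]
    refine Submodule.sum_mem _ fun i hi => ?_
    simp only [contract, LinearMap.comp_apply, LinearMap.lTensor_tmul, LinearEquiv.coe_coe,
      TensorProduct.rid_tmul]
    exact Submodule.smul_mem _ _ (Submodule.subset_span ⟨i, hi, rfl⟩)
  have hstable : ∀ v ∈ V, ∀ g, contract g (comul v) ∈ V := by
    rintro _ ⟨f, rfl⟩ g
    refine ⟨LinearMap.mul' k k ∘ₗ TensorProduct.map g f ∘ₗ comul, ?_⟩
    change contract _ (comul x) = contract g (comul (contract f (comul x)))
    have h := congrArg ((TensorProduct.rid k C).toLinearMap ∘ₗ LinearMap.lTensor C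
      (LinearMap.mul' k k ∘ₗ TensorProduct.map g f)) (coassoc_apply (R := k) x)
    have h1 : ∀ t : C ⊗[k] C, ((TensorProduct.rid k C).toLinearMap ∘ₗ LinearMap.lTensor C
        (LinearMap.mul' k k ∘ₗ TensorProduct.map g f)) (TensorProduct.assoc k C C C
          (LinearMap.rTensor C comul t)) = contract g (comul (contract f t)) := by
      intro t
      induction t with
      | zero => simp
      | add s t hs ht => simp only [map_add, hs, ht]
      | tmul a b =>
        simp only [LinearMap.rTensor_tmul, contract, LinearMap.comp_apply, LinearMap.lTensor_tmul,
          LinearEquiv.coe_coe, TensorProduct.rid_tmul, map_smul]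
        generalize comul (R := k) a = u
        induction u with
        | zero => simp
        | add s t hs ht => simp only [map_add, hs, ht, TensorProduct.add_tmul, smul_add]
        | tmul c d => simp [smul_smul, mul_comm]
    rw [← h1, h]
    simp only [contract, LinearMap.lTensor_comp, LinearMap.comp_apply]
  obtain ⟨P, hP⟩ := V.subtype.exists_leftInverse_of_injective (by simp)
  let w := Module.finBasis k V
  let coord (i) : Module.Dual k C := w.coord i ∘ₗ P
  have hexp : ∀ v ∈ V, v = ∑ i, coord i v • (w i : C) := by
    intro v hv
    have hPv : P v = ⟨v, hv⟩ := LinearMap.congr_fun hP ⟨v, hv⟩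
    have := congrArg V.subtype (w.sum_repr ⟨v, hv⟩)
    rw [map_sum] at this
    simpa only [map_smul, Submodule.subtype_apply, coord, LinearMap.comp_apply, hPv,
      Module.Basis.coord_apply] using this.symm
  have hcoord : ∀ i j, coord i (w j) = (1 : Matrix _ _ k) i j := by
    intro i j
    have hPw : P (w j : C) = w j := LinearMap.congr_fun hP (w j)
    simp [coord, hPw, Matrix.one_apply, Finsupp.single_apply, eq_comm]
  let T : Matrix (Fin (Module.finrank k V)) (Fin (Module.finrank k V)) C := fun i j =>
    TensorProduct.lid k C (LinearMap.rTensor C (coord i) (comul (w j : C)))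
  have hslice : ∀ (g : Module.Dual k C) (f : Module.Dual k C) (t : C ⊗[k] C),
      g (TensorProduct.lid k C (LinearMap.rTensor C f t)) = f (contract g t) := by
    intro g f t
    induction t with
    | zero => simp
    | add s t hs ht => simp only [map_add, hs, ht]
    | tmul a b => simp [contract, mul_comm]
  have hw : ∀ j, comul (R := k) (w j : C) = ∑ i, (w i : C) ⊗ₜ[k] T i j := by
    intro j
    let b := Module.Basis.ofVectorSpace k C
    apply (TensorProduct.equivFinsuppOfBasisRight (M := C) b).injective
    ext m
    rw [TensorProduct.equivFinsuppOfBasisRight_apply]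
    change contract (b.coord m) _ = _
    rw [hexp _ (hstable _ (w j).2 (b.coord m))]
    simp only [map_sum, Finsupp.finsetSum_apply,
      TensorProduct.equivFinsuppOfBasisRight_apply_tmul_apply]
    refine Finset.sum_congr rfl fun i _ => ?_
    rw [← hslice]
    simp [T]
  refine ⟨_, T, ⟨fun i j => ?_, fun i j => ?_⟩, ?_⟩
  · have h := congrArg (TensorProduct.lid k (C ⊗[k] C) ∘ LinearMap.rTensor (C ⊗[k] C) (coord i))
      (coassoc_apply (R := k) (w j : C))
    rw [hw] at h
    have h1 : ∀ t : C ⊗[k] C, TensorProduct.lid k (C ⊗[k] C)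
        (LinearMap.rTensor (C ⊗[k] C) (coord i) (LinearMap.lTensor C comul t)) =
        comul (R := k) (TensorProduct.lid k C (LinearMap.rTensor C (coord i) t)) := by
      intro t
      induction t with
      | zero => simp
      | add s t hs ht => simp only [map_add, hs, ht]
      | tmul a b => simp
    have h2 : ∀ (t : C ⊗[k] C) (c : C), TensorProduct.lid k (C ⊗[k] C)
        (LinearMap.rTensor (C ⊗[k] C) (coord i) (TensorProduct.assoc k C C C (t ⊗ₜ c))) =
        TensorProduct.lid k C (LinearMap.rTensor C (coord i) t) ⊗ₜ[k] c := by
      intro t c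
      induction t with
      | zero => simp
      | add s t hs ht => simp only [map_add, hs, ht, TensorProduct.add_tmul]
      | tmul a b => simp [TensorProduct.smul_tmul']
    rw [← hw] at h
    simp only [Function.comp_apply, h1] at h
    refine h.symm.trans ?_
    rw [hw]
    simp only [map_sum, LinearMap.rTensor_tmul, h2]
    rfl
  · rw [hslice]
    have h1 : contract (counit (R := k)) (comul (w j : C)) = w j := by
      simp [contract]
    rw [h1, hcoord]
  · have hx : x ∈ V := ⟨counit, by simp [orbit, contract]⟩
    rw [hexp x hx]
    refine Submodule.sum_mem _ fun j _ => Submodule.smul_mem _ _ ?_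
    have h1 := congrArg (TensorProduct.lid k C) (rTensor_counit_comul (R := k) (w j : C))
    rw [hw] at h1
    simp only [map_sum, LinearMap.rTensor_tmul, TensorProduct.lid_tmul, one_smul] at h1
    rw [← h1]
    exact Submodule.sum_mem _ fun i _ =>
      Submodule.smul_mem _ _ (Submodule.subset_span ⟨(i, j), rfl⟩)

/-- Linear maps out of a coalgebra agree once they agree on the entries of all comatrices. -/
theorem LinearMap.ext_of_isComatrix {M : Type*} [AddCommGroup M] [Module k M] {f g : C →ₗ[k] M}
    (h : ∀ (n : ℕ) (T : Matrix (Fin n) (Fin n) C), IsComatrix k T → ∀ i j, f (T i j) = g (T i j)) :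
    f = g := by
  ext x
  obtain ⟨n, T, hT, hx⟩ := exists_isComatrix_mem_span (k := k) x
  refine LinearMap.eqOn_span (s := Set.range fun p : Fin n × Fin n => T p.1 p.2) ?_ hx
  rintro _ ⟨p, rfl⟩
  exact h n T hT _ _

end Existence
theorem Fintype.sum_sum_comm {α β γ δ M : Type*} [Fintype α] [Fintype β] [Fintype γ] [Fintype δ]
    [AddCommMonoid M] (f : α → β → γ → δ → M) :
    ∑ a, ∑ b, ∑ c, ∑ d, f a b c d = ∑ c, ∑ d, ∑ a, ∑ b, f a b c d := by
  simpa only [Fintype.sum_prod_type] using Finset.sum_comm (s := Finset.univ) (t := Finset.univ)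
    (f := fun (p : α × β) (q : γ × δ) => f p.1 p.2 q.1 q.2)

namespace IsComatrix

variable {n m : Type*} [Fintype n] [DecidableEq n] [Fintype m] [DecidableEq m]
  {T : Matrix n n O} {U : Matrix m m O}

theorem one : IsComatrix k (1 : Matrix Unit Unit O) where
  comul i j := by simp [Algebra.TensorProduct.one_def]
  counit i j := by simp

/-- The entrywise products of two comatrices form a comatrix. -/
theorem mul (hT : IsComatrix k T) (hU : IsComatrix k U) :
    IsComatrix k (Matrix.of fun p q : n × m => T p.1 q.1 * U p.2 q.2) where
  comul p q := by
    simp only [Matrix.of_apply, Bialgebra.comul_mul, hT.comul, hU.comul, Finset.sum_mul_sum,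
      Algebra.TensorProduct.tmul_mul_tmul, Fintype.sum_prod_type]
  counit p q := by
    simp only [Matrix.of_apply, Bialgebra.counit_mul, hT.counit, hU.counit, Matrix.one_apply,
      Prod.ext_iff]
    split_ifs <;> simp_all

theorem sum_antipode_mul (hT : IsComatrix k T) (i j : n) :
    ∑ a, Sa k O (T i a) * T a j = algebraMap k O ((1 : Matrix n n k) i j) := by
  simpa [hT.comul, hT.counit] using
    HopfAlgebra.mul_antipode_rTensor_comul_apply (R := k) (T i j)

theorem sum_mul_antipode (hT : IsComatrix k T) (i j : n) :
    ∑ a, T i a * Sa k O (T a j) = algebraMap k O ((1 : Matrix n n k) i j) := by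
  simpa [hT.comul, hT.counit] using
    HopfAlgebra.mul_antipode_lTensor_comul_apply (R := k) (T i j)

theorem counit_antipode (hT : IsComatrix k T) (i j : n) :
    Coalgebra.counit (R := k) (Sa k O (T i j)) = (1 : Matrix n n k) i j := by
  rw [HopfAlgebra.counit_antipode, hT.counit]

/-- The antipode reverses the comultiplication of a comatrix. -/
theorem comul_antipode (hT : IsComatrix k T) (i j : n) :
    Coalgebra.comul (R := k) (Sa k O (T i j)) =
      ∑ a, Sa k O (T a j) ⊗ₜ[k] Sa k O (T i a) := by
  let D : Matrix n n (O ⊗[k] O) := Matrix.of fun i j => Coalgebra.comul (T i j)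
  let L : Matrix n n (O ⊗[k] O) := Matrix.of fun i j => Coalgebra.comul (Sa k O (T i j))
  let N : Matrix n n (O ⊗[k] O) := Matrix.of fun i j =>
    ∑ a, Sa k O (T a j) ⊗ₜ[k] Sa k O (T i a)
  have hLD : L * D = 1 := by
    ext i j
    have h := congrArg (Coalgebra.comul (R := k)) (hT.sum_antipode_mul i j)
    simp only [map_sum, Bialgebra.comul_mul, Bialgebra.comul_algebraMap] at h
    simp only [Matrix.mul_apply, L, D, Matrix.of_apply, h]
    by_cases hij : i = j <;> simp [Matrix.one_apply, hij, Algebra.TensorProduct.one_def]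
  have hDN : D * N = 1 := by
    ext i j
    simp only [Matrix.mul_apply, D, N, Matrix.of_apply, hT.comul, Finset.sum_mul_sum,
      Algebra.TensorProduct.tmul_mul_tmul]
    have h : ∀ b d, ∑ a, (T i b * Sa k O (T d j)) ⊗ₜ[k] (T b a * Sa k O (T a d)) =
        if b = d then (T i b * Sa k O (T b j)) ⊗ₜ[k] (1 : O) else 0 := by
      intro b d
      rw [← TensorProduct.tmul_sum, hT.sum_mul_antipode]
      by_cases hbd : b = d <;> simp [Matrix.one_apply, hbd]
    calc _ = ∑ b, ∑ d, ∑ a, (T i b * Sa k O (T d j)) ⊗ₜ[k] (T b a * Sa k O (T a d)) := by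
          rw [Finset.sum_comm]
          exact Finset.sum_congr rfl fun b _ => Finset.sum_comm
      _ = _ := by
          simp only [h, Finset.sum_ite_eq, Finset.mem_univ, if_true, ← TensorProduct.sum_tmul,
            hT.sum_mul_antipode]
          by_cases hij : i = j <;>
            simp [Matrix.one_apply, hij, Algebra.TensorProduct.one_def]
  exact Matrix.ext_iff.mpr (left_inv_eq_right_inv hLD hDN) i j

theorem cad_apply (hT : IsComatrix k T) (i j : n) :
    cad k O (T i j) = ∑ a, ∑ b, T a b ⊗ₜ[k] (Sa k O (T i a) * T b j) := by
  rw [Finset.sum_comm]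
  simp [cad, hT.comul, TensorProduct.sum_tmul]

theorem cad_mul_apply (hU : IsComatrix k U) (φ : O) (i j : m) :
    cad k O (φ * U i j) = ∑ c, ∑ d,
      (1 : O) ⊗ₜ[k] Sa k O (U i c) * cad k O φ * U c d ⊗ₜ[k] U d j := by
  let A : O →ₗ[k] O ⊗[k] O := ∑ c, ∑ d, LinearMap.mulRight k (U c d ⊗ₜ[k] U d j) ∘ₗ
    LinearMap.mulLeft k ((1 : O) ⊗ₜ[k] Sa k O (U i c)) ∘ₗ cad k O
  have h : cad k O ∘ₗ LinearMap.mulRight k (U i j) = A := by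
    refine LinearMap.ext_of_isComatrix fun n T hT a b => ?_
    have := (hT.mul hU).cad_apply (a, i) (b, j)
    simp only [Matrix.of_apply, Fintype.sum_prod_type,
      HopfAlgebra.antipode_mul_antidistrib] at this
    simp only [A, LinearMap.comp_apply, LinearMap.mulRight_apply, LinearMap.sum_apply,
      LinearMap.mulLeft_apply, this, hT.cad_apply, Finset.mul_sum, Finset.sum_mul,
      Algebra.TensorProduct.tmul_mul_tmul, one_mul, mul_assoc]
    rw [Finset.sum_comm]
    refine Finset.sum_congr rfl fun c _ => ?_
    rw [Finset.sum_comm (s := (Finset.univ : Finset m))]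
    exact Finset.sum_congr rfl fun p _ => Finset.sum_comm
  simpa [A] using LinearMap.congr_fun h φ

end IsComatrix

section Coaction

theorem cad_one : cad k O (1 : O) = (1 : O) ⊗ₜ[k] (1 : O) := by
  simp [cad, Algebra.TensorProduct.one_def]

/-- The action on `O` of a functional, through the right adjoint coaction. -/
def cadAct (f : Module.Dual k O) : O →ₗ[k] O :=
  (TensorProduct.rid k O).toLinearMap ∘ₗ LinearMap.lTensor O f ∘ₗ cad k O

/-- The slice `φ ↦ φ₍₁₎ f(φ₍₂₎)`. -/
def sliceRight (f : Module.Dual k O) : O →ₗ[k] O :=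
  (TensorProduct.rid k O).toLinearMap ∘ₗ LinearMap.lTensor O f ∘ₗ Coalgebra.comul

/-- The slice `φ ↦ f(φ₍₁₎) φ₍₂₎`. -/
def sliceLeft (f : Module.Dual k O) : O →ₗ[k] O :=
  (TensorProduct.lid k O).toLinearMap ∘ₗ LinearMap.rTensor O f ∘ₗ Coalgebra.comul

/-- The adjoint coaction is coassociative, contracted with a functional in the last factor. -/
theorem cad_comp_cadAct (f : Module.Dual k O) :
    cad k O ∘ₗ cadAct f = LinearMap.lTensor O (sliceRight f) ∘ₗ cad k O := by
  refine LinearMap.ext_of_isComatrix fun n T hT i j => ?_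
  simp only [cadAct, sliceRight, LinearMap.comp_apply, hT.cad_apply, map_sum,
    LinearMap.lTensor_tmul, LinearEquiv.coe_coe, TensorProduct.rid_tmul, map_smul,
    Bialgebra.comul_mul, hT.comul_antipode, hT.comul, Finset.sum_mul_sum,
    Algebra.TensorProduct.tmul_mul_tmul, TensorProduct.tmul_sum, Finset.smul_sum,
    TensorProduct.tmul_smul]
  exact Fintype.sum_sum_comm _

/-- The adjoint coaction is coassociative, contracted with a functional in the middle factor. -/
theorem rTensor_cadAct_comp_cad (f : Module.Dual k O) :
    LinearMap.rTensor O (cadAct f) ∘ₗ cad k O =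
      LinearMap.lTensor O (sliceLeft f) ∘ₗ cad k O := by
  refine LinearMap.ext_of_isComatrix fun n T hT i j => ?_
  simp only [cadAct, sliceLeft, LinearMap.comp_apply, hT.cad_apply, map_sum,
    LinearMap.lTensor_tmul, LinearMap.rTensor_tmul, LinearEquiv.coe_coe, TensorProduct.rid_tmul,
    TensorProduct.lid_tmul,
    Bialgebra.comul_mul, hT.comul_antipode, hT.comul, Finset.sum_mul_sum,
    Algebra.TensorProduct.tmul_mul_tmul, TensorProduct.tmul_sum, TensorProduct.sum_tmul,
    TensorProduct.tmul_smul, TensorProduct.smul_tmul']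
  exact Fintype.sum_sum_comm _

theorem cadAct_comp_cadAct (f g : Module.Dual k O) :
    cadAct f ∘ₗ cadAct g =
      cadAct (LinearMap.mul' k k ∘ₗ TensorProduct.map f g ∘ₗ Coalgebra.comul) := by
  have h : LinearMap.mul' k k ∘ₗ TensorProduct.map f g ∘ₗ Coalgebra.comul = f ∘ₗ sliceRight g := by
    ext x
    simp only [sliceRight, LinearMap.comp_apply]
    generalize Coalgebra.comul (R := k) x = t
    induction t with
    | zero => simp
    | add s t hs ht => simp only [map_add, hs, ht]
    | tmul a b => simp [mul_comm]
  rw [h]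
  conv_lhs => rw [cadAct]
  rw [LinearMap.comp_assoc, LinearMap.comp_assoc, cad_comp_cadAct, cadAct, LinearMap.lTensor_comp,
    LinearMap.comp_assoc]

theorem cadAct_counit : cadAct (Coalgebra.counit (R := k) (A := O)) = LinearMap.id := by
  refine LinearMap.ext_of_isComatrix fun n T hT i j => ?_
  simp [cadAct, hT.cad_apply, HopfAlgebra.counit_antipode, hT.counit, Matrix.one_apply, ite_smul]

theorem cadAct_one (f : Module.Dual k O) : cadAct f (1 : O) = f 1 • 1 := by
  simp [cadAct, cad_one]

theorem kappa_eq_comm_cad (φ : O) : kappa k O φ = commO k O (cad k O φ) := by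
  refine LinearMap.congr_fun (f := kappa k O) (g := commO k O ∘ₗ cad k O) ?_ φ
  refine LinearMap.ext_of_isComatrix fun n T hT i j => ?_
  simp [kappa, hT.cad_apply, hT.comul, TensorProduct.tmul_sum]

end Coaction

section Transmutation

/-- The functional `φ ↦ R(φ ⊗ b)`. -/
abbrev pairWith (b : O) : Module.Dual k O := R ∘ₗ (TensorProduct.mk k O O).flip b

theorem transMul_tmul_comatrix {n : Type*} [Fintype n] [DecidableEq n] {U : Matrix n n O}
    (hU : IsComatrix k U) (φ : O) (i j : n) :
    transMul R (φ ⊗ₜ[k] U i j) = ∑ c, cadAct (pairWith R (Sa k O (U i c))) φ * U c j := by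
  simp only [transMul, lamS, cadAct, LinearMap.comp_apply, TensorProduct.map_tmul,
    kappa_eq_comm_cad, hU.comul]
  generalize cad k O φ = t
  induction t with
  | zero => simp
  | add s t hs ht => simp only [map_add, TensorProduct.add_tmul, hs, ht, add_mul,
      Finset.sum_add_distrib]
  | tmul a b => simp [TensorProduct.tmul_sum]

/-- An idempotent with a right inverse is the identity. -/
theorem eq_one_of_mul_self_of_mul_eq_one {M : Type*} [Monoid M] {x y : M} (h : x * x = x)
    (hxy : x * y = 1) : x = 1 := by
  rw [← hxy]
  nth_rw 2 [← h]
  rw [mul_assoc, hxy, mul_one]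

variable {R}

theorem pairing_one_left (hconv : ∃ R' : O ⊗[k] O →ₗ[k] k,
      LinearMap.mul' k k ∘ₗ TensorProduct.map R R' ∘ₗ
          (Coalgebra.comul : O ⊗[k] O →ₗ[k] (O ⊗[k] O) ⊗[k] (O ⊗[k] O)) =
        (Coalgebra.counit : O ⊗[k] O →ₗ[k] k))
    (hmul_left : R ∘ₗ LinearMap.rTensor O (mulO k O) =
      LinearMap.mul' k k ∘ₗ TensorProduct.map R R ∘ₗ ttt k O ∘ₗ
        LinearMap.lTensor (O ⊗[k] O) Coalgebra.comul)
    (b : O) : R (1 ⊗ₜ[k] b) = Coalgebra.counit (R := k) b := by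
  obtain ⟨R', hR'⟩ := hconv
  refine LinearMap.congr_fun (f := R ∘ₗ TensorProduct.mk k O O 1) (g := Coalgebra.counit) ?_ b
  refine LinearMap.ext_of_isComatrix fun n U hU i j => ?_
  let M : Matrix (Fin n) (Fin n) k := Matrix.of fun i j => R (1 ⊗ₜ[k] U i j)
  let M' : Matrix (Fin n) (Fin n) k := Matrix.of fun i j => R' (1 ⊗ₜ[k] U i j)
  have hM : M * M = M := by
    ext i j
    have h := LinearMap.congr_fun hmul_left ((1 ⊗ₜ[k] 1) ⊗ₜ[k] U i j)
    simpa [M, Matrix.mul_apply, hU.comul, TensorProduct.tmul_sum] using h.symm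
  have hMM' : M * M' = 1 := by
    ext i j
    have h := LinearMap.congr_fun hR' (1 ⊗ₜ[k] U i j)
    simpa [M, M', Matrix.mul_apply, hU.comul, hU.counit, TensorProduct.tmul_sum,
      Algebra.TensorProduct.one_def] using h
  have h := Matrix.ext_iff.mpr (eq_one_of_mul_self_of_mul_eq_one hM hMM') i j
  simpa [M, hU.counit] using h

theorem pairing_one_right (hconv : ∃ R' : O ⊗[k] O →ₗ[k] k,
      LinearMap.mul' k k ∘ₗ TensorProduct.map R R' ∘ₗ
          (Coalgebra.comul : O ⊗[k] O →ₗ[k] (O ⊗[k] O) ⊗[k] (O ⊗[k] O)) =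
        (Coalgebra.counit : O ⊗[k] O →ₗ[k] k))
    (hmul_right : R ∘ₗ LinearMap.lTensor O (mulO k O) =
      LinearMap.mul' k k ∘ₗ TensorProduct.map R R ∘ₗ ttt k O ∘ₗ
        LinearMap.lTensor (O ⊗[k] O) (commO k O) ∘ₗ
          LinearMap.rTensor (O ⊗[k] O) Coalgebra.comul)
    (a : O) : R (a ⊗ₜ[k] 1) = Coalgebra.counit (R := k) a := by
  obtain ⟨R', hR'⟩ := hconv
  refine LinearMap.congr_fun (f := R ∘ₗ (TensorProduct.mk k O O).flip 1) (g := Coalgebra.counit)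
    ?_ a
  refine LinearMap.ext_of_isComatrix fun n T hT i j => ?_
  let M : Matrix (Fin n) (Fin n) k := Matrix.of fun i j => R (T i j ⊗ₜ[k] 1)
  let M' : Matrix (Fin n) (Fin n) k := Matrix.of fun i j => R' (T i j ⊗ₜ[k] 1)
  have hM : M * M = M := by
    ext i j
    have h := LinearMap.congr_fun hmul_right (T i j ⊗ₜ[k] (1 ⊗ₜ[k] 1))
    simpa [M, Matrix.mul_apply, hT.comul, TensorProduct.sum_tmul] using h.symm
  have hMM' : M * M' = 1 := by
    ext i j
    have h := LinearMap.congr_fun hR' (T i j ⊗ₜ[k] 1)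
    simpa [M, M', Matrix.mul_apply, hT.comul, hT.counit, TensorProduct.sum_tmul,
      Algebra.TensorProduct.one_def] using h
  have h := Matrix.ext_iff.mpr (eq_one_of_mul_self_of_mul_eq_one hM hMM') i j
  simpa [M, hT.counit] using h

theorem cadAct_pairWith_mul (hmul_right : R ∘ₗ LinearMap.lTensor O (mulO k O) =
      LinearMap.mul' k k ∘ₗ TensorProduct.map R R ∘ₗ ttt k O ∘ₗ
        LinearMap.lTensor (O ⊗[k] O) (commO k O) ∘ₗ
          LinearMap.rTensor (O ⊗[k] O) Coalgebra.comul)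
    (φ b c : O) :
    cadAct (pairWith R (b * c)) φ = cadAct (pairWith R c) (cadAct (pairWith R b) φ) := by
  have h : pairWith R (b * c) = LinearMap.mul' k k ∘ₗ
      TensorProduct.map (pairWith R c) (pairWith R b) ∘ₗ Coalgebra.comul := by
    ext a
    have h := LinearMap.congr_fun hmul_right (a ⊗ₜ[k] (b ⊗ₜ[k] c))
    simp only [LinearMap.comp_apply, LinearMap.lTensor_tmul, LinearMap.rTensor_tmul,
      LinearMap.mul'_apply] at h
    simp only [pairWith, LinearMap.comp_apply, LinearMap.flip_apply, TensorProduct.mk_apply, h]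
    generalize Coalgebra.comul (R := k) a = t
    induction t with
    | zero => simp
    | add s t hs ht => simp only [map_add, TensorProduct.add_tmul, hs, ht]
    | tmul x y => simp
  rw [h, ← cadAct_comp_cadAct, LinearMap.comp_apply]

/-- The quasi-commutativity of `O`, in terms of slices by the co-R-matrix. -/
theorem sum_mul_sliceRight_eq (hcomm : (TensorProduct.rid k O).toLinearMap ∘ₗ
        TensorProduct.map (mulO k O ∘ₗ commO k O) R ∘ₗ ttt k O ∘ₗ
          TensorProduct.map Coalgebra.comul Coalgebra.comul =
      (TensorProduct.lid k O).toLinearMap ∘ₗ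
        TensorProduct.map R (mulO k O) ∘ₗ ttt k O ∘ₗ
          TensorProduct.map Coalgebra.comul Coalgebra.comul)
    {n : Type*} [Fintype n] {b : O} {x y : n → O}
    (hb : Coalgebra.comul (R := k) b = ∑ c, x c ⊗ₜ[k] y c) (a : O) :
    ∑ c, x c * sliceRight (pairWith R (y c)) a = ∑ c, sliceLeft (pairWith R (x c)) a * y c := by
  have h := LinearMap.congr_fun hcomm (a ⊗ₜ[k] b)
  simp only [LinearMap.comp_apply, TensorProduct.map_tmul, hb, TensorProduct.tmul_sum,
    map_sum] at h
  refine Eq.trans (Finset.sum_congr rfl fun c _ => ?_)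
    (h.trans (Finset.sum_congr rfl fun c _ => ?_))
  · simp only [sliceRight, LinearMap.comp_apply]
    generalize Coalgebra.comul (R := k) a = t
    induction t with
    | zero => simp
    | add s t hs ht => simp only [map_add, TensorProduct.add_tmul, mul_add, hs, ht]
    | tmul p q => simp
  · simp only [sliceLeft, LinearMap.comp_apply]
    generalize Coalgebra.comul (R := k) a = t
    induction t with
    | zero => simp
    | add s t hs ht => simp only [map_add, TensorProduct.add_tmul, add_mul, hs, ht]
    | tmul p q => simp

theorem sum_mul_cad_cadAct (hcomm : (TensorProduct.rid k O).toLinearMap ∘ₗ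
        TensorProduct.map (mulO k O ∘ₗ commO k O) R ∘ₗ ttt k O ∘ₗ
          TensorProduct.map Coalgebra.comul Coalgebra.comul =
      (TensorProduct.lid k O).toLinearMap ∘ₗ
        TensorProduct.map R (mulO k O) ∘ₗ ttt k O ∘ₗ
          TensorProduct.map Coalgebra.comul Coalgebra.comul)
    {n : Type*} [Fintype n] {b : O} {x y : n → O}
    (hb : Coalgebra.comul (R := k) b = ∑ c, x c ⊗ₜ[k] y c) (φ : O) :
    ∑ c, (1 : O) ⊗ₜ[k] x c * cad k O (cadAct (pairWith R (y c)) φ) =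
      ∑ c, LinearMap.rTensor O (cadAct (pairWith R (x c))) (cad k O φ) * (1 : O) ⊗ₜ[k] y c := by
  have h1 (f : Module.Dual k O) := LinearMap.congr_fun (cad_comp_cadAct f) φ
  have h2 (f : Module.Dual k O) := LinearMap.congr_fun (rTensor_cadAct_comp_cad f) φ
  simp only [LinearMap.comp_apply] at h1 h2
  simp only [h1, h2]
  generalize cad k O φ = t
  induction t with
  | zero => simp
  | add s t hs ht => simp only [map_add, mul_add, add_mul, Finset.sum_add_distrib, hs, ht]
  | tmul p q =>
    simp only [LinearMap.lTensor_tmul, Algebra.TensorProduct.tmul_mul_tmul, one_mul, mul_one,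
      ← TensorProduct.tmul_sum, sum_mul_sliceRight_eq hcomm hb]

/-- The transmutation product is a morphism of comodules for the adjoint coaction. -/
theorem cad_comp_transMul (hcomm : (TensorProduct.rid k O).toLinearMap ∘ₗ
        TensorProduct.map (mulO k O ∘ₗ commO k O) R ∘ₗ ttt k O ∘ₗ
          TensorProduct.map Coalgebra.comul Coalgebra.comul =
      (TensorProduct.lid k O).toLinearMap ∘ₗ
        TensorProduct.map R (mulO k O) ∘ₗ ttt k O ∘ₗ
          TensorProduct.map Coalgebra.comul Coalgebra.comul) :
    cad k O ∘ₗ transMul R =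
      TensorProduct.map (transMul R) (mulO k O) ∘ₗ ttt k O ∘ₗ
        TensorProduct.map (cad k O) (cad k O) := by
  refine TensorProduct.ext' fun φ ψ => ?_
  refine LinearMap.congr_fun (f := (cad k O ∘ₗ transMul R) ∘ₗ TensorProduct.mk k O O φ)
    (g := (TensorProduct.map (transMul R) (mulO k O) ∘ₗ ttt k O ∘ₗ
      TensorProduct.map (cad k O) (cad k O)) ∘ₗ TensorProduct.mk k O O φ) ?_ ψ
  refine LinearMap.ext_of_isComatrix fun n U hU i j => ?_
  simp only [TensorProduct.mk_apply, LinearMap.comp_apply,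
    TensorProduct.map_tmul, transMul_tmul_comatrix R hU, map_sum, hU.cad_mul_apply]
  trans ∑ d, ∑ e, ∑ c, LinearMap.rTensor O (cadAct (pairWith R (Sa k O (U c d)))) (cad k O φ) *
      (1 : O) ⊗ₜ[k] Sa k O (U i c) * U d e ⊗ₜ[k] U e j
  · rw [Finset.sum_comm]
    refine Finset.sum_congr rfl fun d _ => ?_
    rw [Finset.sum_comm]
    refine Finset.sum_congr rfl fun e _ => ?_
    rw [← Finset.sum_mul, ← Finset.sum_mul, sum_mul_cad_cadAct hcomm (hU.comul_antipode i d)]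
  · rw [hU.cad_apply]
    generalize cad k O φ = t
    induction t with
    | zero => simp
    | add s t hs ht =>
      simp only [map_add, TensorProduct.add_tmul, add_mul, Finset.sum_add_distrib, hs, ht]
    | tmul p q =>
      simp only [LinearMap.rTensor_tmul, Algebra.TensorProduct.tmul_mul_tmul, mul_one,
        TensorProduct.tmul_sum, map_sum, LinearEquiv.coe_coe,
        TensorProduct.tensorTensorTensorComm_tmul, TensorProduct.map_tmul,
        transMul_tmul_comatrix R hU, LinearMap.mul'_apply, TensorProduct.sum_tmul, mul_assoc]
      rw [Finset.sum_comm]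
      conv_rhs => rw [Finset.sum_comm]
      exact Finset.sum_congr rfl fun e _ => Finset.sum_comm

/-- The transmutation product is equivariant for the action through `R`. -/
theorem cadAct_pairWith_transMul (hmul_left : R ∘ₗ LinearMap.rTensor O (mulO k O) =
      LinearMap.mul' k k ∘ₗ TensorProduct.map R R ∘ₗ ttt k O ∘ₗ
        LinearMap.lTensor (O ⊗[k] O) Coalgebra.comul)
    (hcomm : (TensorProduct.rid k O).toLinearMap ∘ₗ
        TensorProduct.map (mulO k O ∘ₗ commO k O) R ∘ₗ ttt k O ∘ₗ
          TensorProduct.map Coalgebra.comul Coalgebra.comul =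
      (TensorProduct.lid k O).toLinearMap ∘ₗ
        TensorProduct.map R (mulO k O) ∘ₗ ttt k O ∘ₗ
          TensorProduct.map Coalgebra.comul Coalgebra.comul)
    {n : Type*} [Fintype n] {b : O} {x y : n → O}
    (hb : Coalgebra.comul (R := k) b = ∑ c, x c ⊗ₜ[k] y c) (φ ψ : O) :
    cadAct (pairWith R b) (transMul R (φ ⊗ₜ[k] ψ)) =
      ∑ c, transMul R (cadAct (pairWith R (x c)) φ ⊗ₜ[k] cadAct (pairWith R (y c)) ψ) := by
  have h := LinearMap.congr_fun (cad_comp_transMul hcomm) (φ ⊗ₜ[k] ψ)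
  simp only [LinearMap.comp_apply, TensorProduct.map_tmul] at h
  simp only [cadAct, LinearMap.comp_apply, h]
  generalize cad k O φ = s
  generalize cad k O ψ = t
  induction s with
  | zero => simp
  | add s₁ s₂ h₁ h₂ => simp only [map_add, TensorProduct.add_tmul, Finset.sum_add_distrib, h₁, h₂]
  | tmul p q =>
    induction t with
    | zero => simp
    | add t₁ t₂ h₁ h₂ =>
      simp only [map_add, TensorProduct.tmul_add, Finset.sum_add_distrib, h₁, h₂]
    | tmul v w =>
      have hqw := LinearMap.congr_fun hmul_left ((q ⊗ₜ[k] w) ⊗ₜ[k] b)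
      simp only [LinearMap.comp_apply, LinearMap.rTensor_tmul, LinearMap.lTensor_tmul, hb,
        TensorProduct.tmul_sum, map_sum, LinearMap.mul'_apply, LinearEquiv.coe_coe,
        TensorProduct.tensorTensorTensorComm_tmul, TensorProduct.map_tmul] at hqw
      simp [hqw, Finset.sum_smul, ← TensorProduct.smul_tmul', smul_smul, mul_comm]

theorem transMul_tmul_mul_comatrix (hmul_right : R ∘ₗ LinearMap.lTensor O (mulO k O) =
      LinearMap.mul' k k ∘ₗ TensorProduct.map R R ∘ₗ ttt k O ∘ₗ
        LinearMap.lTensor (O ⊗[k] O) (commO k O) ∘ₗ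
          LinearMap.rTensor (O ⊗[k] O) Coalgebra.comul)
    {n : Type*} [Fintype n] [DecidableEq n] {U : Matrix n n O} (hU : IsComatrix k U)
    (φ ψ : O) (i j : n) :
    transMul R (φ ⊗ₜ[k] (ψ * U i j)) =
      ∑ c, transMul R (cadAct (pairWith R (Sa k O (U i c))) φ ⊗ₜ[k] ψ) * U c j := by
  let F : O →ₗ[k] O := ∑ c, LinearMap.mulRight k (U c j) ∘ₗ transMul R ∘ₗ
    TensorProduct.mk k O O (cadAct (pairWith R (Sa k O (U i c))) φ)
  have h : transMul R ∘ₗ TensorProduct.mk k O O φ ∘ₗ LinearMap.mulRight k (U i j) = F := by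
    refine LinearMap.ext_of_isComatrix fun m T hT a b => ?_
    have := transMul_tmul_comatrix R (hT.mul hU) φ (a, i) (b, j)
    simp only [Matrix.of_apply, Fintype.sum_prod_type, HopfAlgebra.antipode_mul_antidistrib,
      cadAct_pairWith_mul hmul_right] at this
    simp only [F, LinearMap.comp_apply, LinearMap.mulRight_apply, LinearMap.sum_apply,
      TensorProduct.mk_apply, this, transMul_tmul_comatrix R hT, Finset.sum_mul, mul_assoc]
    exact Finset.sum_comm
  simpa [F] using LinearMap.congr_fun h ψ

/-- Associativity of the transmutation product. -/
theorem transMul_assoc (hmul_left : R ∘ₗ LinearMap.rTensor O (mulO k O) =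
      LinearMap.mul' k k ∘ₗ TensorProduct.map R R ∘ₗ ttt k O ∘ₗ
        LinearMap.lTensor (O ⊗[k] O) Coalgebra.comul)
    (hmul_right : R ∘ₗ LinearMap.lTensor O (mulO k O) =
      LinearMap.mul' k k ∘ₗ TensorProduct.map R R ∘ₗ ttt k O ∘ₗ
        LinearMap.lTensor (O ⊗[k] O) (commO k O) ∘ₗ
          LinearMap.rTensor (O ⊗[k] O) Coalgebra.comul)
    (hcomm : (TensorProduct.rid k O).toLinearMap ∘ₗ
        TensorProduct.map (mulO k O ∘ₗ commO k O) R ∘ₗ ttt k O ∘ₗ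
          TensorProduct.map Coalgebra.comul Coalgebra.comul =
      (TensorProduct.lid k O).toLinearMap ∘ₗ
        TensorProduct.map R (mulO k O) ∘ₗ ttt k O ∘ₗ
          TensorProduct.map Coalgebra.comul Coalgebra.comul) :
    transMul R ∘ₗ LinearMap.rTensor O (transMul R) =
      transMul R ∘ₗ LinearMap.lTensor O (transMul R) ∘ₗ
        (TensorProduct.assoc k O O O).toLinearMap := by
  refine TensorProduct.ext_threefold fun φ ψ χ => ?_
  refine LinearMap.congr_fun
    (f := transMul R ∘ₗ TensorProduct.mk k O O (transMul R (φ ⊗ₜ[k] ψ)))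
    (g := transMul R ∘ₗ TensorProduct.mk k O O φ ∘ₗ transMul R ∘ₗ TensorProduct.mk k O O ψ) ?_ χ
  refine LinearMap.ext_of_isComatrix fun n U hU i j => ?_
  simp only [LinearMap.comp_apply, TensorProduct.mk_apply, transMul_tmul_comatrix R hU,
    map_sum, transMul_tmul_mul_comatrix hmul_right hU,
    cadAct_pairWith_transMul hmul_left hcomm (hU.comul_antipode i _), Finset.sum_mul]
  exact Finset.sum_comm

theorem one_transMul (hconv : ∃ R' : O ⊗[k] O →ₗ[k] k,
      LinearMap.mul' k k ∘ₗ TensorProduct.map R R' ∘ₗ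
          (Coalgebra.comul : O ⊗[k] O →ₗ[k] (O ⊗[k] O) ⊗[k] (O ⊗[k] O)) =
        (Coalgebra.counit : O ⊗[k] O →ₗ[k] k))
    (hmul_left : R ∘ₗ LinearMap.rTensor O (mulO k O) =
      LinearMap.mul' k k ∘ₗ TensorProduct.map R R ∘ₗ ttt k O ∘ₗ
        LinearMap.lTensor (O ⊗[k] O) Coalgebra.comul)
    (φ : O) : transMul R ((1 : O) ⊗ₜ[k] φ) = φ := by
  refine LinearMap.congr_fun (f := transMul R ∘ₗ TensorProduct.mk k O O 1) (g := .id) ?_ φ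
  refine LinearMap.ext_of_isComatrix fun n U hU i j => ?_
  simp [transMul_tmul_comatrix R hU, cadAct_one, pairing_one_left hconv hmul_left,
    hU.counit_antipode, Matrix.one_apply, ite_smul]

theorem transMul_one (hconv : ∃ R' : O ⊗[k] O →ₗ[k] k,
      LinearMap.mul' k k ∘ₗ TensorProduct.map R R' ∘ₗ
          (Coalgebra.comul : O ⊗[k] O →ₗ[k] (O ⊗[k] O) ⊗[k] (O ⊗[k] O)) =
        (Coalgebra.counit : O ⊗[k] O →ₗ[k] k))
    (hmul_right : R ∘ₗ LinearMap.lTensor O (mulO k O) =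
      LinearMap.mul' k k ∘ₗ TensorProduct.map R R ∘ₗ ttt k O ∘ₗ
        LinearMap.lTensor (O ⊗[k] O) (commO k O) ∘ₗ
          LinearMap.rTensor (O ⊗[k] O) Coalgebra.comul)
    (φ : O) : transMul R (φ ⊗ₜ[k] (1 : O)) = φ := by
  have h := transMul_tmul_comatrix R (IsComatrix.one (k := k) (O := O)) φ () ()
  have h1 : pairWith R (1 : O) = Coalgebra.counit := by
    ext a
    exact pairing_one_right hconv hmul_right a
  simpa [h1, cadAct_counit] using h

end Transmutation

/-- Let `O` be a coquasitriangular Hopf algebra over a field `k` with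
co-R-matrix `R : O ⊗ O → k`, and let `L` denote `O` with the right adjoint coaction
`cad(φ) = φ₍₂₎ ⊗ S(φ₍₁₎)φ₍₃₎` and the braided (transmutation) product
`φ ⊙ ψ = R(S(φ₍₁₎)φ₍₃₎ ⊗ S(ψ₍₁₎)) φ₍₂₎ψ₍₂₎` with unit `1`.  Then `⊙` is associative with
unit `1`, and the coadjoint coaction makes `(L, ⊙, 1)` an algebra object in the category
of right `O`-comodules: `⊙` and the unit are comodule morphisms. -/
theorem transmutation_is_comodule_algebra
    -- the antipode is invertible:
    (hS : Function.Bijective (Sa k O))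
    -- `R` is convolution invertible (as a functional on the coalgebra `O ⊗ O`):
    (hconv : ∃ R' : O ⊗[k] O →ₗ[k] k,
      LinearMap.mul' k k ∘ₗ TensorProduct.map R R' ∘ₗ
          (Coalgebra.comul : O ⊗[k] O →ₗ[k] (O ⊗[k] O) ⊗[k] (O ⊗[k] O)) =
        (Coalgebra.counit : O ⊗[k] O →ₗ[k] k) ∧
      LinearMap.mul' k k ∘ₗ TensorProduct.map R' R ∘ₗ
          (Coalgebra.comul : O ⊗[k] O →ₗ[k] (O ⊗[k] O) ⊗[k] (O ⊗[k] O)) =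
        (Coalgebra.counit : O ⊗[k] O →ₗ[k] k))
    -- `R(φψ ⊗ χ) = R(φ ⊗ χ₍₁₎) R(ψ ⊗ χ₍₂₎)`:
    (hmul_left : R ∘ₗ LinearMap.rTensor O (mulO k O) =
      LinearMap.mul' k k ∘ₗ TensorProduct.map R R ∘ₗ ttt k O ∘ₗ
        LinearMap.lTensor (O ⊗[k] O) Coalgebra.comul)
    -- `R(φ ⊗ ψχ) = R(φ₍₁₎ ⊗ χ) R(φ₍₂₎ ⊗ ψ)`:
    (hmul_right : R ∘ₗ LinearMap.lTensor O (mulO k O) =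
      LinearMap.mul' k k ∘ₗ TensorProduct.map R R ∘ₗ ttt k O ∘ₗ
        LinearMap.lTensor (O ⊗[k] O) (commO k O) ∘ₗ
          LinearMap.rTensor (O ⊗[k] O) Coalgebra.comul)
    -- `ψ₍₁₎ φ₍₁₎ R(φ₍₂₎ ⊗ ψ₍₂₎) = R(φ₍₁₎ ⊗ ψ₍₁₎) φ₍₂₎ ψ₍₂₎`:
    (hcomm : (TensorProduct.rid k O).toLinearMap ∘ₗ
        TensorProduct.map (mulO k O ∘ₗ commO k O) R ∘ₗ ttt k O ∘ₗ
          TensorProduct.map Coalgebra.comul Coalgebra.comul =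
      (TensorProduct.lid k O).toLinearMap ∘ₗ
        TensorProduct.map R (mulO k O) ∘ₗ ttt k O ∘ₗ
          TensorProduct.map Coalgebra.comul Coalgebra.comul) :
    -- `⊙` is associative:
    (transMul R ∘ₗ LinearMap.rTensor O (transMul R) =
      transMul R ∘ₗ LinearMap.lTensor O (transMul R) ∘ₗ
        (TensorProduct.assoc k O O O).toLinearMap) ∧
    -- `1` is a two-sided unit for `⊙`:
    (∀ φ : O, transMul R ((1 : O) ⊗ₜ[k] φ) = φ) ∧
    (∀ φ : O, transMul R (φ ⊗ₜ[k] (1 : O)) = φ) ∧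
    -- `⊙` is a morphism of comodules for the adjoint coaction
    -- (the coaction on `O ⊗ O` being the tensor product coaction):
    (cad k O ∘ₗ transMul R =
      TensorProduct.map (transMul R) (mulO k O) ∘ₗ ttt k O ∘ₗ
        TensorProduct.map (cad k O) (cad k O)) ∧
    -- the unit is a comodule morphism:
    (cad k O (1 : O) = (1 : O) ⊗ₜ[k] (1 : O)) := by
  have hconv' := hconv.imp fun _ h => h.1
  exact ⟨transMul_assoc hmul_left hmul_right hcomm, one_transMul hconv' hmul_left,
    transMul_one hconv' hmul_right, cad_comp_transMul hcomm, cad_one⟩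

end
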